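/- arXiv:1512.08823 — 2 statements merged into one kernel-verified Lean document; each statement's English description precedes it below -/
import Mathlib

section
/- Let A = (Σ, Q, δ, I) be a top-down tree automaton and let R be a strict partial order on Q (irreflexive and transitive) that is contained in the upward trace inclusion ⊆up(id) induced by the identity relation. Then P(R, id) is good for pruning, i.e., L(Prune(A, P(R, id))) = L(A), where P(R, id) relates two rules ⟨p,σ,r₁⋯rₙ⟩ and ⟨p′,σ,r₁⋯rₙ⟩ with the same symbol and the same tuple of target states iff p R p′. -/
/-- A tree over a ranked alphabet: a partial map from nodes (lists of child
indices) to symbols, with finite, prefix-closed domain respecting ranks. -/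
structure RTree (α : Type) (rank : α → ℕ) where
  label : List ℕ → Option α
  finite : Set.Finite {v : List ℕ | label v ≠ none}
  prefixClosed : ∀ v i, label (v ++ [i]) ≠ none → ∃ a, label v = some a ∧ i < rank a

namespace RTree

variable {α : Type} {rank : α → ℕ}

/-- A tree is closed if every node has all the children prescribed by the rank
of its symbol. -/
def IsClosed (t : RTree α rank) : Prop :=
  ∀ v a, t.label v = some a → ∀ i, i < rank a → t.label (v ++ [i]) ≠ none

/-- The domain of a run on `t`: the nodes of `t` together with all (possibly
dangling) children of nodes of `t`. -/
def inRunDom (t : RTree α rank) (v : List ℕ) : Prop :=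
  t.label v ≠ none ∨ ∃ v' i a, v = v' ++ [i] ∧ t.label v' = some a ∧ i < rank a

/-- A leaf of `t`: a node of `t` with no children in `t`. -/
def IsLeaf (t : RTree α rank) (v : List ℕ) : Prop :=
  t.label v ≠ none ∧ ∀ i, t.label (v ++ [i]) = none

end RTree

/-- A (nondeterministic, top-down) tree automaton, with a distinguished final
state `top`; leaf rules have right-hand side `[top]`, and rules for symbols of
positive rank have right-hand side of length equal to the rank. -/
structure TDTA (Q α : Type) (rank : α → ℕ) where
  top : Q
  init : Set Q
  delta : Set (Q × α × List Q)
  rank_ok : ∀ τ ∈ delta, (rank τ.2.1 = 0 → τ.2.2 = [top]) ∧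
    (0 < rank τ.2.1 → τ.2.2.length = rank τ.2.1)

namespace TDTA

variable {Q α : Type} {rank : α → ℕ}

/-- The right-hand side that a run `π` must match at node `v` labelled `a`. -/
def rhsOf (A : TDTA Q α rank) (a : α) (π : List ℕ → Q) (v : List ℕ) : List Q :=
  if rank a = 0 then [A.top] else (List.range (rank a)).map fun i => π (v ++ [i])

/-- `π` is a run of `A` on the tree `t`. -/
def IsRun (A : TDTA Q α rank) (t : RTree α rank) (π : List ℕ → Q) : Prop :=
  ∀ v a, t.label v = some a → (π v, a, A.rhsOf a π v) ∈ A.delta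

/-- The downward language of a state: closed trees accepted from it. -/
def dlang (A : TDTA Q α rank) (q : Q) : Set (RTree α rank) :=
  {t | t.IsClosed ∧ ∃ π, A.IsRun t π ∧ π [] = q}

/-- The language of the automaton. -/
def lang (A : TDTA Q α rank) : Set (RTree α rank) :=
  {t | ∃ q ∈ A.init, t ∈ A.dlang q}

/-- Pruning: keep exactly the transitions that are maximal w.r.t. `P`. -/
def prune (A : TDTA Q α rank) (P : Q × α × List Q → Q × α × List Q → Prop) :
    TDTA Q α rank where
  top := A.top
  init := A.init
  delta := {τ | τ ∈ A.delta ∧ ¬∃ τ' ∈ A.delta, P τ τ'}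
  rank_ok := fun τ hτ => A.rank_ok τ hτ.1

/-- Downward trace inclusion `q ⊆dw r`. -/
def dwIncl (A : TDTA Q α rank) (q r : Q) : Prop :=
  ∀ t : RTree α rank, t.IsClosed → ∀ π, A.IsRun t π → π [] = q →
    ∃ π', A.IsRun t π' ∧ π' [] = r

/-- Upward trace inclusion `q ⊆up(R) r` induced by a relation `R`. -/
def upIncl (A : TDTA Q α rank) (R : Q → Q → Prop) (q r : Q) : Prop :=
  (q = A.top → r = A.top) ∧
  ∀ (t : RTree α rank) (v : List ℕ), t.IsLeaf v →
    ∀ πq, A.IsRun t πq → πq v = q →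
      ∃ πr, A.IsRun t πr ∧ πr v = r ∧
        (∀ v', v' <+: v → πq v' ∈ A.init → πr v' ∈ A.init) ∧
        ∀ v' x, v' <+: v → v' ≠ v → t.inRunDom (v' ++ [x]) → ¬(v' ++ [x]) <+: v →
          R (πq (v' ++ [x])) (πr (v' ++ [x]))

/-- `D` is a downward simulation on `A`. -/
def IsDwSim (A : TDTA Q α rank) (D : Q → Q → Prop) : Prop :=
  ∀ q r, D q r → (q = A.top → r = A.top) ∧
    ∀ a qs, (q, a, qs) ∈ A.delta →
      ∃ rs, (r, a, rs) ∈ A.delta ∧ List.Forall₂ D qs rs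

/-- The maximal downward simulation `≼dw` (the union of all downward
simulations). -/
def dwSim (A : TDTA Q α rank) (q r : Q) : Prop :=
  ∃ D, A.IsDwSim D ∧ D q r

/-- `U` is an upward simulation on `A` induced by `R`. -/
def IsUpSim (A : TDTA Q α rank) (R U : Q → Q → Prop) : Prop :=
  ∀ q r, U q r → (q = A.top → r = A.top) ∧ (q ∈ A.init → r ∈ A.init) ∧
    ∀ q' a qs, (q', a, qs) ∈ A.delta → ∀ i : Fin qs.length, qs.get i = q →
      ∃ r' rs, ∃ hlen : rs.length = qs.length, (r', a, rs) ∈ A.delta ∧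
        rs.get (Fin.cast hlen.symm i) = r ∧ U q' r' ∧
        ∀ j : Fin qs.length, j ≠ i → R (qs.get j) (rs.get (Fin.cast hlen.symm j))

/-- The maximal upward simulation `≼up(R)` induced by `R`. -/
def upSim (A : TDTA Q α rank) (R : Q → Q → Prop) (q r : Q) : Prop :=
  ∃ U, A.IsUpSim R U ∧ U q r

/-- `W` is a downup-relation on `A`. -/
def IsDownUp (A : TDTA Q α rank) (W : Q → Q → Prop) : Prop :=
  ∀ p q, W p q → ∀ (t : RTree α rank) (π : List ℕ → Q), A.IsRun t π → π [] = p →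
    ∃ π', A.IsRun t π' ∧ π' [] = q ∧ ∀ v, t.inRunDom v → A.upSim W (π v) (π' v)

end TDTA

/-- The strict version `S ∖ S⁻¹` of a relation `S`. -/
def strictOf {Q : Type} (S : Q → Q → Prop) (q r : Q) : Prop := S q r ∧ ¬S r q

/-- Lifting of relations to tuples: pointwise `Dw` everywhere and `Ds` at some
position. -/
def liftStrict {Q : Type} (Dw Ds : Q → Q → Prop) (qs rs : List Q) : Prop :=
  List.Forall₂ Dw qs rs ∧
    ∃ (i : ℕ) (h : i < qs.length) (h' : i < rs.length), Ds (qs.get ⟨i, h⟩) (rs.get ⟨i, h'⟩)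

/-- The pruning relation `P(U, Dl)` comparing transitions with the same symbol:
sources by `U`, target tuples by `Dl`. -/
def pruneRel {Q α : Type} (U : Q → Q → Prop) (Dl : List Q → List Q → Prop) :
    Q × α × List Q → Q × α × List Q → Prop :=
  fun τ τ' => U τ.1 τ'.1 ∧ τ.2.1 = τ'.2.1 ∧ Dl τ.2.2 τ'.2.2

namespace RTree

/-- Remove everything strictly below `v`. -/
def cut {α : Type} {rank : α → ℕ} (t : RTree α rank) (v : List ℕ) : RTree α rank where
  label := fun w => if v <+: w ∧ w ≠ v then none else t.label w
  finite := by
    apply t.finite.subset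
    intro w hw
    simp only [Set.mem_ofPred_eq] at hw ⊢
    split_ifs at hw <;> simp_all
  prefixClosed := by
    intro u i h
    split_ifs at h with h1
    · exact absurd rfl h
    · obtain ⟨a, ha, hi⟩ := t.prefixClosed u i h
      refine ⟨a, ?_, hi⟩
      rw [if_neg]
      · exact ha
      · rintro ⟨hp, hne⟩
        apply h1
        refine ⟨hp.trans (List.prefix_append u [i]), ?_⟩
        intro he
        have := hp.length_le
        rw [← he] at this
        simp at this

end RTree

namespace TDTA

variable {Q α : Type} {rank : α → ℕ}

theorem rhsOf_congr (A : TDTA Q α rank) (a : α) (π π' : List ℕ → Q) (v : List ℕ)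
    (h : ∀ i, i < rank a → π (v ++ [i]) = π' (v ++ [i])) : A.rhsOf a π v = A.rhsOf a π' v := by
  unfold rhsOf
  split_ifs
  · rfl
  · apply List.map_congr_left
    intro i hi
    exact h i (List.mem_range.1 hi)

theorem fix_node (A : TDTA Q α rank) (t : RTree α rank) (π : List ℕ → Q) (hπ : A.IsRun t π)
    (v : List ℕ) (s : α) (hv : t.label v = some s) (p : Q)
    (hp : (p, s, A.rhsOf s π v) ∈ A.delta) (hup : A.upIncl Eq (π v) p) :
    ∃ π', A.IsRun t π' ∧ π' v = p ∧ (π [] ∈ A.init → π' [] ∈ A.init) ∧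
      ∀ w, ¬ w <+: v → π' w = π w := by
  have hleaf : (t.cut v).IsLeaf v := by
    constructor
    · simp [RTree.cut, hv]
    · intro i
      simp [RTree.cut]
  have hrun : A.IsRun (t.cut v) π := by
    intro u a hu
    apply hπ
    simp only [RTree.cut] at hu
    split_ifs at hu
    exact hu
  obtain ⟨ρ, hρ, hρv, hinit, hside⟩ := hup.2 (t.cut v) v hleaf π hrun rfl
  refine ⟨fun w => if w <+: v then ρ w else π w, ?_, ?_, ?_, ?_⟩
  · intro u a hu
    by_cases h1 : u <+: v
    · by_cases h2 : u = v
      · subst h2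
        obtain rfl : s = a := by simpa [hv] using hu
        rw [A.rhsOf_congr s _ π]
        · simpa [hρv] using hp
        · intro i _
          rw [if_neg]
          intro hh
          have := hh.length_le
          simp at this
      · have hlab : (t.cut v).label u = some a := by
          simp only [RTree.cut]
          rw [if_neg]
          · exact hu
          · rintro ⟨h3, _⟩
            exact h2 (h1.eq_of_length_le h3.length_le)
        have := hρ u a hlab
        rw [A.rhsOf_congr a _ ρ]
        · simpa [h1] using this
        · intro i hi
          split_ifs with h3
          · rfl
          · exact hside u i h1 h2 (Or.inr ⟨u, i, a, rfl, hlab, hi⟩) h3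
    · rw [A.rhsOf_congr a _ π]
      · simpa [h1] using hπ u a hu
      · intro i _
        rw [if_neg]
        intro hh
        exact h1 ((List.prefix_append u [i]).trans hh)
  · simp [hρv]
  · intro h
    simpa using hinit [] List.nil_prefix h
  · intro w hw
    simp [hw]

theorem exists_good (A : TDTA Q α rank) [Finite Q] (R : Q → Q → Prop)
    (hirr : ∀ q, ¬R q q) (htrans : ∀ a b c, R a b → R b c → R a c)
    (hsub : ∀ q r, R q r → A.upIncl Eq q r) (t : RTree α rank)
    (π : List ℕ → Q) (hπ : A.IsRun t π) (hi : π [] ∈ A.init) (l : List (List ℕ))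
    (hl : l.Pairwise (fun a b => a.length ≤ b.length)) :
    ∃ π', A.IsRun t π' ∧ π' [] ∈ A.init ∧ ∀ w ∈ l, ∀ a, t.label w = some a →
      (π' w, a, A.rhsOf a π' w) ∈ (A.prune (pruneRel R Eq)).delta := by
  induction l with
  | nil => exact ⟨π, hπ, hi, by simp⟩
  | cons v l ih =>
    rw [List.pairwise_cons] at hl
    obtain ⟨ρ, hρ, hρi, hgood⟩ := ih hl.2
    by_cases hb : ∀ a, t.label v = some a →
      (ρ v, a, A.rhsOf a ρ v) ∈ (A.prune (pruneRel R Eq)).delta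
    · refine ⟨ρ, hρ, hρi, ?_⟩
      intro w hw
      rcases List.mem_cons.1 hw with rfl | hw
      · exact hb
      · exact hgood w hw
    · push Not at hb
      obtain ⟨s, hs, hbad⟩ := hb
      have hex : ∃ p, R (ρ v) p ∧ (p, s, A.rhsOf s ρ v) ∈ A.delta := by
        by_contra hno
        apply hbad
        refine ⟨hρ v s hs, ?_⟩
        rintro ⟨⟨p, s', rs⟩, hd, h1, h2, h3⟩
        dsimp only at h1 h2 h3
        subst h2 h3
        exact hno ⟨p, h1, hd⟩
      have hwf : WellFounded (fun a b => R b a) := by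
        have : Std.Irrefl (fun a b => R b a) := ⟨fun a => hirr a⟩
        have : IsTrans Q (fun a b => R b a) := ⟨fun a b c h1 h2 => htrans _ _ _ h2 h1⟩
        exact Finite.wellFounded_of_trans_of_irrefl _
      obtain ⟨p, ⟨hRp, hpd⟩, hmax⟩ :=
        hwf.has_min {p | R (ρ v) p ∧ (p, s, A.rhsOf s ρ v) ∈ A.delta} hex
      obtain ⟨π', hr, hv, hin, hoff⟩ := A.fix_node t ρ hρ v s hs p hpd (hsub _ _ hRp)
      have hch : ∀ w, v.length ≤ w.length → ∀ a, A.rhsOf a π' w = A.rhsOf a ρ w := by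
        intro w hw a
        apply A.rhsOf_congr
        intro i _
        apply hoff
        intro hh
        have := hh.length_le
        simp at this
        omega
      have hgv : ∀ a, t.label v = some a →
          (π' v, a, A.rhsOf a π' v) ∈ (A.prune (pruneRel R Eq)).delta := by
        intro a ha
        obtain rfl : s = a := by simpa [hs] using ha
        rw [hch v le_rfl, hv]
        refine ⟨hpd, ?_⟩
        rintro ⟨⟨p', s', rs⟩, hd, h1, h2, h3⟩
        dsimp only at h1 h2 h3
        subst h2 h3
        exact hmax p' ⟨htrans _ _ _ hRp h1, hd⟩ h1
      refine ⟨π', hr, hin hρi, ?_⟩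
      intro w hw
      by_cases hwv : w = v
      · subst hwv
        exact hgv
      · have hwl : w ∈ l := by
          rcases List.mem_cons.1 hw with h | h
          · exact absurd h hwv
          · exact h
        intro a ha
        have hlen := hl.1 w hwl
        rw [hch w hlen, hoff w (fun h => hwv (h.eq_of_length_le hlen))]
        exact hgood w hwl a ha

end TDTA

/-- For every strict partial order `R` contained in the upward trace inclusion
induced by the identity, `P(R, id)` is good for pruning. -/
theorem statement_1 {Q α : Type} [Fintype Q] [Fintype α] {rank : α → ℕ}
    (A : TDTA Q α rank) (R : Q → Q → Prop)
    (hirr : ∀ q, ¬R q q) (htrans : ∀ a b c, R a b → R b c → R a c)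
    (hsub : ∀ q r, R q r → A.upIncl Eq q r) :
    (A.prune (pruneRel R Eq)).lang = A.lang := by
  ext t
  constructor
  · rintro ⟨q, hq, hc, π, hπ, h0⟩
    exact ⟨q, hq, hc, π, fun v a h => (hπ v a h).1, h0⟩
  · rintro ⟨q, hq, hc, π, hπ, rfl⟩
    let l := t.finite.toFinset.toList.insertionSort (fun a b => a.length ≤ b.length)
    have : Std.Total (fun a b : List ℕ => a.length ≤ b.length) := ⟨fun a b => le_total _ _⟩
    have : IsTrans (List ℕ) (fun a b : List ℕ => a.length ≤ b.length) :=
      ⟨fun a b c => le_trans⟩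
    obtain ⟨π', hr, hi, hg⟩ := A.exists_good R hirr htrans hsub t π hπ hq l
      (List.pairwise_insertionSort _ _)
    refine ⟨π' [], hi, hc, π', ?_, rfl⟩
    intro v a h
    exact hg v (by simp [l, h]) a h
end

section
/- There exists a top-down tree automaton A = (Σ, Q, δ, I) for which the equivalence ≡ := ≼up(≼dw ∩ (≼dw)⁻¹) ∩ (≼up(≼dw ∩ (≼dw)⁻¹))⁻¹ is not good for quotienting, i.e., L(A/≡) ≠ L(A). (A witness is the automaton of the paper's Figure 4, with Σ₀ = {a,b}, Σ₂ = {c}, for which the quotient additionally accepts the tree c(b,a).) -/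
/-- The quotient automaton `A/≡` w.r.t. a setoid `s` on its states. -/
def TDTA.quotAut {Q α : Type} {rank : α → ℕ} (A : TDTA Q α rank) (s : Setoid Q) :
    TDTA (Quotient s) α rank where
  top := Quotient.mk s A.top
  init := {x | ∃ q ∈ A.init, x = Quotient.mk s q}
  delta := {τ | ∃ q a qs, (q, a, qs) ∈ A.delta ∧
    τ = (Quotient.mk s q, a, qs.map fun p => Quotient.mk s p)}
  rank_ok := by
    rintro τ ⟨q, a, qs, hmem, rfl⟩
    refine ⟨fun h0 => ?_, fun h0 => ?_⟩
    · have h : qs = [A.top] := (A.rank_ok _ hmem).1 h0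
      simp [h]
    · simpa using (A.rank_ok _ hmem).2 h0

namespace W16

variable {Q α : Type} {rank : α → ℕ}

theorem dw_refl (A : TDTA Q α rank) (q : Q) : A.dwSim q q := by
  refine ⟨Eq, ?_, rfl⟩
  rintro q r rfl
  refine ⟨id, fun a qs h => ⟨qs, h, ?_⟩⟩
  exact List.forall₂_refl qs

theorem dw_trans (A : TDTA Q α rank) {p q r : Q} (h1 : A.dwSim p q) (h2 : A.dwSim q r) :
    A.dwSim p r := by
  obtain ⟨D, hD, h1⟩ := h1
  obtain ⟨E, hE, h2⟩ := h2
  refine ⟨Relation.Comp D E, ?_, q, h1, h2⟩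
  rintro x z ⟨y, hxy, hyz⟩
  refine ⟨fun h => (hE _ _ hyz).1 ((hD _ _ hxy).1 h), fun a qs h => ?_⟩
  obtain ⟨rs, hr, hqr⟩ := (hD _ _ hxy).2 a qs h
  obtain ⟨ts, ht, hrt⟩ := (hE _ _ hyz).2 a rs hr
  refine ⟨ts, ht, ?_⟩
  clear h hr ht
  induction hqr generalizing ts with
  | nil => cases hrt; exact .nil
  | cons h _ ih => cases hrt with | cons h' t' => exact .cons ⟨_, h, h'⟩ (ih _ t')

theorem up_refl (A : TDTA Q α rank) (R : Q → Q → Prop) (hR : ∀ q, R q q) (q : Q) :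
    A.upSim R q q := by
  refine ⟨Eq, ?_, rfl⟩
  rintro q r rfl
  refine ⟨id, id, fun q' a qs h i hi => ⟨q', qs, rfl, h, hi, rfl, fun j _ => hR _⟩⟩

theorem up_trans (A : TDTA Q α rank) (R : Q → Q → Prop)
    (hR : ∀ p q r, R p q → R q r → R p r) {p q r : Q}
    (h1 : A.upSim R p q) (h2 : A.upSim R q r) : A.upSim R p r := by
  obtain ⟨D, hD, h1⟩ := h1
  obtain ⟨E, hE, h2⟩ := h2
  refine ⟨Relation.Comp D E, ?_, q, h1, h2⟩
  rintro x z ⟨y, hxy, hyz⟩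
  obtain ⟨a1, a2, a3⟩ := hD _ _ hxy
  obtain ⟨b1, b2, b3⟩ := hE _ _ hyz
  refine ⟨b1 ∘ a1, b2 ∘ a2, fun q' a qs h i hi => ?_⟩
  obtain ⟨r', rs, hl, hr, hri, hu, hj⟩ := a3 q' a qs h i hi
  obtain ⟨t', ts, hl', ht, hti, hu', hj'⟩ := b3 r' a rs hr _ hri
  refine ⟨t', ts, hl'.trans hl, ht, hti, ⟨_, hu, hu'⟩, fun j hji => ?_⟩
  refine hR _ _ _ (hj j hji) (hj' (Fin.cast hl.symm j) ?_)
  intro h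
  exact hji (Fin.cast_injective _ h)

def rk : Fin 3 → ℕ := ![0, 0, 2]

def B : TDTA (Fin 7) (Fin 3) rk where
  top := 6
  init := {0}
  delta := {τ | τ ∈ ([(0, 2, [1, 3]), (0, 2, [2, 5]), (0, 2, [5, 4]), (1, 0, [6]), (3, 0, [6]),
    (5, 0, [6]), (2, 1, [6]), (4, 1, [6])] : List (Fin 7 × Fin 3 × List (Fin 7)))}
  rank_ok := by
    intro τ h
    simp only [Set.mem_setOf_eq, List.mem_cons, List.not_mem_nil, or_false] at h
    rcases h with rfl | rfl | rfl | rfl | rfl | rfl | rfl | rfl <;> simp [rk]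

def R (x y : Fin 7) : Prop := B.dwSim x y ∧ B.dwSim y x

theorem memB (q : Fin 7) (a : Fin 3) (qs : List (Fin 7)) : (q, a, qs) ∈ B.delta ↔
    (q, a, qs) ∈ ([(0, 2, [1, 3]), (0, 2, [2, 5]), (0, 2, [5, 4]), (1, 0, [6]), (3, 0, [6]),
    (5, 0, [6]), (2, 1, [6]), (4, 1, [6])] : List (Fin 7 × Fin 3 × List (Fin 7))) := Iff.rfl

theorem dwB (x y : Fin 7) (hx : x = 1 ∨ x = 3 ∨ x = 5) (hy : y = 1 ∨ y = 3 ∨ y = 5) :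
    B.dwSim x y := by
  refine ⟨fun x y => (x = 6 ∧ y = 6) ∨
    ((x = 1 ∨ x = 3 ∨ x = 5) ∧ (y = 1 ∨ y = 3 ∨ y = 5)), ?_, Or.inr ⟨hx, hy⟩⟩
  clear hx hy x y
  rintro x y (⟨rfl, rfl⟩ | ⟨hx, hy⟩)
  · refine ⟨id, fun a qs h => ?_⟩
    simp [memB] at h
  · refine ⟨?_, fun a qs h => ⟨[6], ?_, ?_⟩⟩
    · rcases hx with rfl | rfl | rfl <;> simp [B]
    · rcases hx with rfl | rfl | rfl <;> rcases hy with rfl | rfl | rfl <;>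
        simp [memB] at h ⊢ <;> exact h.1
    · rcases hx with rfl | rfl | rfl <;> simp [memB] at h <;> simp [h.2]

theorem RB (x y : Fin 7) (hx : x = 1 ∨ x = 3 ∨ x = 5) (hy : y = 1 ∨ y = 3 ∨ y = 5) : R x y :=
  ⟨dwB x y hx hy, dwB y x hy hx⟩

/-- The upward simulation used. -/
def U (x y : Fin 7) : Prop := (x = 0 ∧ y = 0) ∨
  ((x = 1 ∨ x = 2) ∧ (y = 1 ∨ y = 2)) ∨ ((x = 3 ∨ x = 4) ∧ (y = 3 ∨ y = 4))

theorem R_refl (x : Fin 7) : R x x := ⟨dw_refl _ _, dw_refl _ _⟩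

theorem upB : B.IsUpSim R U := by
  rintro x y hU
  refine ⟨?_, ?_, ?_⟩
  · rintro rfl
    simp [U, B] at hU
  · intro h
    have : x = 0 := h
    subst this
    simpa [U, B] using hU
  · intro q a qs h i hi
    simp only [memB, List.mem_cons, List.not_mem_nil, or_false, Prod.mk.injEq] at h
    have key : ∀ l : List (Fin 7), ((0 : Fin 7), (2 : Fin 3), l) ∈ B.delta → q = 0 → a = 2 →
        ∀ hl : l.length = qs.length, l.get (Fin.cast hl.symm i) = y →
        (∀ j : Fin qs.length, j ≠ i → R (qs.get j) (l.get (Fin.cast hl.symm j))) →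
        ∃ r' rs, ∃ hlen : rs.length = qs.length, (r', a, rs) ∈ B.delta ∧
          rs.get (Fin.cast hlen.symm i) = y ∧ U q r' ∧
          ∀ j : Fin qs.length, j ≠ i → R (qs.get j) (rs.get (Fin.cast hlen.symm j)) := by
      intro l hl hq ha hlen h1 h2
      subst hq ha
      exact ⟨0, l, hlen, hl, h1, Or.inl ⟨rfl, rfl⟩, h2⟩
    rcases h with ⟨hq, ha, rfl⟩ | ⟨hq, ha, rfl⟩ | ⟨hq, ha, rfl⟩ | ⟨hq, ha, rfl⟩ | ⟨hq, ha, rfl⟩ |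
      ⟨hq, ha, rfl⟩ | ⟨hq, ha, rfl⟩ | ⟨hq, ha, rfl⟩ <;> fin_cases i <;> simp at hi <;> subst hi <;>
      simp [U] at hU
    all_goals
      rcases hU with rfl | rfl
      all_goals
        first
        | (refine key [1, 3] (by simp [memB]) hq ha rfl rfl ?_
           intro j hj; fin_cases j <;> first | exact absurd rfl hj | exact RB _ _ (by simp) (by simp))
        | (refine key [2, 5] (by simp [memB]) hq ha rfl rfl ?_
           intro j hj; fin_cases j <;> first | exact absurd rfl hj | exact RB _ _ (by simp) (by simp))
        | (refine key [5, 4] (by simp [memB]) hq ha rfl rfl ?_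
           intro j hj; fin_cases j <;> first | exact absurd rfl hj | exact RB _ _ (by simp) (by simp))

def S : Setoid (Fin 7) where
  r q r := B.upSim R q r ∧ B.upSim R r q
  iseqv :=
    { refl := fun q => ⟨up_refl _ _ R_refl q, up_refl _ _ R_refl q⟩
      symm := fun h => ⟨h.2, h.1⟩
      trans := fun h h' =>
        have hR : ∀ p q r, R p q → R q r → R p r := fun _ _ _ h h' =>
          ⟨dw_trans _ h.1 h'.1, dw_trans _ h'.2 h.2⟩
        ⟨up_trans _ _ hR h.1 h'.1, up_trans _ _ hR h'.2 h.2⟩ }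

theorem e12 : Quotient.mk S 1 = Quotient.mk S 2 :=
  Quotient.sound ⟨⟨U, upB, by simp [U]⟩, ⟨U, upB, by simp [U]⟩⟩

theorem e34 : Quotient.mk S 3 = Quotient.mk S 4 :=
  Quotient.sound ⟨⟨U, upB, by simp [U]⟩, ⟨U, upB, by simp [U]⟩⟩

def lab (v : List ℕ) : Option (Fin 3) :=
  if v = [] then some 2 else if v = [0] ∨ v = [1] then some 1 else none

theorem lab_cases {v : List ℕ} {a : Fin 3} (h : lab v = some a) :
    (v = [] ∧ a = 2) ∨ (v = [0] ∧ a = 1) ∨ (v = [1] ∧ a = 1) := by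
  unfold lab at h
  split_ifs at h with h1 h2
  · simp at h; exact Or.inl ⟨h1, h.symm⟩
  · simp at h; rcases h2 with h2 | h2 <;> simp [h2, h.symm]

def T : RTree (Fin 3) rk where
  label := lab
  finite := by
    refine Set.Finite.subset (Set.toFinite ({[], [0], [1]} : Set (List ℕ))) ?_
    intro v hv
    obtain ⟨a, ha⟩ := Option.ne_none_iff_exists'.1 hv
    rcases lab_cases ha with h | h | h <;> simp [h.1]
  prefixClosed := by
    intro v i h
    obtain ⟨a, ha⟩ := Option.ne_none_iff_exists'.1 h
    refine ⟨2, ?_⟩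
    rcases lab_cases ha with h | h | h
    · simp at h
    · have := List.append_inj' (h.1.trans (List.nil_append [0]).symm) rfl
      simp at this
      simp [this, lab, rk]
    · have := List.append_inj' (h.1.trans (List.nil_append [1]).symm) rfl
      simp at this
      simp [this, lab, rk]

theorem T_closed : T.IsClosed := by
  intro v a h i hi
  rcases lab_cases h with ⟨rfl, rfl⟩ | ⟨rfl, rfl⟩ | ⟨rfl, rfl⟩ <;> simp [rk] at hi
  interval_cases i <;> simp [T, lab]

theorem T_quot : T ∈ (B.quotAut S).lang := by
  refine ⟨Quotient.mk S 0, ⟨0, rfl, rfl⟩, T_closed,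
    fun v => if v = [] then Quotient.mk S 0 else if v = [0] then Quotient.mk S 2 else
      Quotient.mk S 4, ?_, by simp⟩
  intro v a h
  rcases lab_cases h with ⟨rfl, rfl⟩ | ⟨rfl, rfl⟩ | ⟨rfl, rfl⟩
  · refine ⟨0, 2, [1, 3], by simp [memB], ?_⟩
    simp [TDTA.rhsOf, rk, List.range_succ, e12, e34]
  · refine ⟨2, 1, [6], by simp [memB], ?_⟩
    simp [TDTA.rhsOf, rk, TDTA.quotAut, B]
  · refine ⟨4, 1, [6], by simp [memB], ?_⟩
    simp [TDTA.rhsOf, rk, TDTA.quotAut, B]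

theorem T_not : T ∉ B.lang := by
  rintro ⟨q, hq, -, π, hπ, h0⟩
  have h1 := hπ [] 2 rfl
  have h2 := hπ [0] 1 rfl
  have h3 := hπ [1] 1 rfl
  simp [TDTA.rhsOf, rk, List.range_succ, memB] at h1 h2 h3
  omega

end W16

/-- There is a tree automaton for which the equivalence induced by the upward
simulation induced by downward simulation equivalence is not good for
quotienting. -/
theorem statement_16 : ∃ (Q α : Type) (_ : Fintype Q) (_ : Fintype α)
    (rank : α → ℕ) (A : TDTA Q α rank) (s : Setoid Q),
    (∀ q r, s.r q r ↔
      (A.upSim (fun x y => A.dwSim x y ∧ A.dwSim y x) q r ∧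
       A.upSim (fun x y => A.dwSim x y ∧ A.dwSim y x) r q)) ∧
    (A.quotAut s).lang ≠ A.lang := by
  exact ⟨Fin 7, Fin 3, inferInstance, inferInstance, W16.rk, W16.B, W16.S,
    fun q r => Iff.rfl, fun h => W16.T_not (h ▸ W16.T_quot)⟩
end
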